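/- Let χ be a fixed smooth even cutoff function on ℝ with χ(λ) = 1 for |λ| ≤ λ₁/2 and χ(λ) = 0 for |λ| ≥ λ₁, where λ₁ ∈ (0,1/2] is a fixed sufficiently small constant. Then there is a constant C (depending only on χ) such that for all t > 2 and all x, y ∈ ℝ²: | ∫₀^∞ e^{itλ²} λ χ(λ) (i/2) J₀(λ|x−y|) dλ + 1/(4t) | ≤ C ⟨x⟩^{3/2} ⟨y⟩^{3/2} / t^{5/4}. (Here (i/2)J₀(λ|x−y|) is the kernel of R₀⁺(λ²) − R₀⁻(λ²), the jump of the free resolvent of −Δ on ℝ² across the spectrum.) -/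

import Mathlib

open MeasureTheory Real Set Complex

noncomputable section

/-- The plane `ℝ²`. -/
abbrev Plane : Type := EuclideanSpace ℝ (Fin 2)

/-- The Bessel function of the first kind of order zero,
`J₀(z) = (1/π) ∫₀^π cos(z sin θ) dθ`. -/
def J0 (z : ℝ) : ℝ := (1 / Real.pi) * ∫ θ in (0:ℝ)..Real.pi, Real.cos (z * Real.sin θ)

/-- The Japanese bracket `⟨x⟩ = (1+|x|²)^{1/2}`. -/
def jap (x : Plane) : ℝ := (1 + ‖x‖ ^ 2) ^ ((1:ℝ)/2)

/-- The amplitude `λ e^{itλ²} / (1 + 2itλ²)`, an approximate primitive of `e^{itλ²}` that is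
uniformly `O(t^{-1/2})`. -/
def fresnelPrimitive (t l : ℝ) : ℂ :=
  l * Complex.exp (Complex.I * t * l ^ 2) / (1 + 2 * Complex.I * t * l ^ 2)

/-- The difference between `e^{itλ²}` and the derivative of `fresnelPrimitive t`. -/
def fresnelError (t l : ℝ) : ℂ :=
  Complex.exp (Complex.I * t * l ^ 2) *
    (4 * Complex.I * t * l ^ 2 / (1 + 2 * Complex.I * t * l ^ 2) ^ 2)

lemma norm_sq_one_add_two_mul_I (t l : ℝ) :
    ‖(1 + 2 * Complex.I * t * l ^ 2 : ℂ)‖ ^ 2 = 1 + 4 * t ^ 2 * l ^ 4 := by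
  have : (1 + 2 * Complex.I * t * l ^ 2 : ℂ) = ⟨1, 2 * t * l ^ 2⟩ := by
    apply Complex.ext <;> simp [← Complex.ofReal_pow]
  rw [this, ← Complex.normSq_eq_norm_sq, Complex.normSq_mk]
  ring

lemma one_add_two_mul_I_ne_zero (t l : ℝ) : (1 + 2 * Complex.I * t * l ^ 2 : ℂ) ≠ 0 := by
  intro h
  have := norm_sq_one_add_two_mul_I t l
  rw [h] at this
  simp at this
  nlinarith [sq_nonneg (t * l ^ 2)]

lemma norm_exp_I_mul_sq (t l : ℝ) : ‖Complex.exp (Complex.I * t * l ^ 2)‖ = 1 := by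
  have : (Complex.I * t * l ^ 2 : ℂ) = ((t * l ^ 2 : ℝ) : ℂ) * Complex.I := by
    push_cast; ring
  rw [this, Complex.norm_exp_ofReal_mul_I]

lemma hasDerivAt_exp_I_mul_sq (t l : ℝ) :
    HasDerivAt (fun l : ℝ => Complex.exp (Complex.I * t * l ^ 2))
      (Complex.exp (Complex.I * t * l ^ 2) * (2 * Complex.I * t * l)) l := by
  have h : HasDerivAt (fun z : ℂ => Complex.exp (Complex.I * t * z ^ 2))
      (Complex.exp (Complex.I * t * l ^ 2) * (2 * Complex.I * t * l)) (l : ℂ) := by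
    refine (((hasDerivAt_pow 2 (l : ℂ)).const_mul (Complex.I * t)).cexp).congr_deriv ?_
    push_cast
    ring
  exact h.comp_ofReal

lemma hasDerivAt_fresnelPrimitive (t l : ℝ) :
    HasDerivAt (fresnelPrimitive t)
      (Complex.exp (Complex.I * t * l ^ 2) - fresnelError t l) l := by
  have hne := one_add_two_mul_I_ne_zero t l
  have hq : HasDerivAt (fun l : ℝ => (1 + 2 * Complex.I * t * l ^ 2 : ℂ))
      (4 * Complex.I * t * l) l := by
    have h : HasDerivAt (fun z : ℂ => 1 + 2 * Complex.I * t * z ^ 2)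
        (4 * Complex.I * t * l) (l : ℂ) := by
      refine (((hasDerivAt_pow 2 (l : ℂ)).const_mul (2 * Complex.I * t)).const_add 1).congr_deriv ?_
      push_cast
      ring
    exact h.comp_ofReal
  have hl : HasDerivAt (fun l : ℝ => (l : ℂ)) 1 l := (hasDerivAt_id (l : ℂ)).comp_ofReal
  refine ((hl.mul (hasDerivAt_exp_I_mul_sq t l)).div hq hne).congr_deriv ?_
  unfold fresnelError
  rw [div_eq_iff (pow_ne_zero 2 hne), sub_mul, mul_assoc (Complex.exp _),
    div_mul_cancel₀ _ (pow_ne_zero 2 hne)]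
  simp only [Pi.mul_apply]
  ring

lemma norm_fresnelPrimitive_le {t : ℝ} (ht : 0 < t) (l : ℝ) :
    ‖fresnelPrimitive t l‖ ≤ 1 / √t := by
  have hs : 0 < √t := Real.sqrt_pos.2 ht
  have hpos := norm_pos_iff.2 (one_add_two_mul_I_ne_zero t l)
  have hn := norm_sq_one_add_two_mul_I t l
  unfold fresnelPrimitive
  rw [norm_div, norm_mul, norm_exp_I_mul_sq, mul_one, Complex.norm_real, Real.norm_eq_abs,
    div_le_div_iff₀ hpos hs, one_mul]
  refine le_of_sq_le_sq ?_ hpos.le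
  rw [hn, mul_pow, sq_abs, Real.sq_sqrt ht.le]
  nlinarith [sq_nonneg (2 * t * l ^ 2 - 1), mul_nonneg ht.le (sq_nonneg l)]

lemma mul_norm_fresnelError_le {t l : ℝ} (ht : 0 < t) (hl : 0 ≤ l) :
    l * ‖fresnelError t l‖ ≤ 2 / √t := by
  have hs : 0 < √t := Real.sqrt_pos.2 ht
  have hn := norm_sq_one_add_two_mul_I t l
  have hpos : 0 < 1 + 4 * t ^ 2 * l ^ 4 := by positivity
  have h4 : ‖(4 * Complex.I * t * l ^ 2 : ℂ)‖ = 4 * t * l ^ 2 := by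
    simp [abs_of_pos ht]
  unfold fresnelError
  rw [norm_mul, norm_exp_I_mul_sq, one_mul, norm_div, norm_pow, hn, h4, ← mul_div_assoc,
    div_le_div_iff₀ hpos hs]
  have ht2 : t = √t ^ 2 := (Real.sq_sqrt ht.le).symm
  set s := √t with hsdef
  clear_value s
  subst ht2
  have hu : 0 ≤ s * l := by positivity
  nlinarith [mul_nonneg (sq_nonneg (s * l)) (sq_nonneg (s * l - 1)), sq_nonneg ((s * l) ^ 2 - 1),
    sq_nonneg (s * l), sq_nonneg ((s * l) ^ 2)]

/-- Oscillatory integral estimate by one integration by parts against `fresnelPrimitive`. -/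
lemma norm_integral_exp_mul_le {t L B : ℝ} (ht : 0 < t) (hL : 0 < L) (hL' : L ≤ 1 / 2)
    (hB : 1 ≤ B) {h h' : ℝ → ℝ} (hd : ∀ l, HasDerivAt h (h' l) l) (hc : Continuous h')
    (h0 : h 0 = 0) (hb : ∀ l ∈ Icc 0 L, |h l| ≤ B) (hb' : ∀ l ∈ Icc 0 L, |h' l| ≤ B ^ 2) :
    ‖∫ l in (0 : ℝ)..L, Complex.exp (Complex.I * t * l ^ 2) * (h l : ℂ)‖ ≤
      2 * B ^ ((3 : ℝ) / 2) / t ^ ((1 : ℝ) / 4) := by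
  set A := ‖∫ l in (0 : ℝ)..L, Complex.exp (Complex.I * t * l ^ 2) * (h l : ℂ)‖ with hA
  have hs : 0 < √t := Real.sqrt_pos.2 ht
  have hcont : Continuous h := continuous_iff_continuousAt.2 fun l => (hd l).continuousAt
  have hsub : ∀ l ∈ Set.uIoc 0 L, l ∈ Icc 0 L := fun l hl => by
    rw [uIoc_of_le hL.le] at hl; exact ⟨hl.1.le, hl.2⟩
  have trivial_bound : A ≤ B := by
    have := intervalIntegral.norm_integral_le_of_norm_le_const (a := 0) (b := L) (C := B)
      (f := fun l : ℝ => Complex.exp (Complex.I * t * l ^ 2) * (h l : ℂ)) fun l hl => by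
        rw [norm_mul, norm_exp_I_mul_sq, one_mul, Complex.norm_real]
        exact hb l (hsub l hl)
    rw [sub_zero, abs_of_pos hL] at this
    nlinarith
  have hlin : ∀ l ∈ Icc 0 L, |h l| ≤ B ^ 2 * l := by
    intro l hl
    have := (convex_Icc (0 : ℝ) L).norm_image_sub_le_of_norm_hasDerivWithin_le
      (f := h) (f' := h') (C := B ^ 2) (fun x _ => (hd x).hasDerivWithinAt) hb'
      (left_mem_Icc.2 hL.le) hl
    simpa [h0, abs_of_nonneg hl.1] using this
  have hcE : Continuous (fresnelError t) := by
    unfold fresnelError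
    refine Continuous.mul (by fun_prop) (Continuous.div (by fun_prop) (by fun_prop) fun l => ?_)
    exact pow_ne_zero _ (one_add_two_mul_I_ne_zero t l)
  have hcG : Continuous (fresnelPrimitive t) :=
    continuous_iff_continuousAt.2 fun l => (hasDerivAt_fresnelPrimitive t l).continuousAt
  have hparts := intervalIntegral.integral_deriv_mul_eq_sub (a := 0) (b := L)
    (u := fresnelPrimitive t) (v := fun l => (h l : ℂ)) (v' := fun l => (h' l : ℂ))
    (fun l _ => hasDerivAt_fresnelPrimitive t l) (fun l _ => (hd l).ofReal_comp)
    (Continuous.intervalIntegrable (by fun_prop) _ _)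
    (Continuous.intervalIntegrable (by fun_prop) _ _)
  have hsplit : (∫ l in (0 : ℝ)..L, Complex.exp (Complex.I * t * l ^ 2) * (h l : ℂ)) =
      fresnelPrimitive t L * h L -
        ∫ l in (0 : ℝ)..L, (fresnelPrimitive t l * h' l - fresnelError t l * h l) := by
    have : fresnelPrimitive t L * h L =
        fresnelPrimitive t L * h L - fresnelPrimitive t 0 * h 0 := by
      simp [h0]
    rw [this, ← hparts, ← intervalIntegral.integral_sub
      (Continuous.intervalIntegrable (by fun_prop) _ _)
      (Continuous.intervalIntegrable (by fun_prop) _ _)]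
    congr 1
    ext l
    ring
  have decay_bound : A ≤ 3 * B ^ 2 / √t := by
    have hrem := intervalIntegral.norm_integral_le_of_norm_le_const (a := 0) (b := L)
      (C := 3 * B ^ 2 / √t)
      (f := fun l : ℝ => fresnelPrimitive t l * h' l - fresnelError t l * h l) fun l hl => by
        have hl := hsub l hl
        refine (norm_sub_le _ _).trans ?_
        rw [norm_mul, norm_mul, Complex.norm_real, Complex.norm_real]
        have h1 : ‖fresnelPrimitive t l‖ * ‖h' l‖ ≤ 1 / √t * B ^ 2 :=
          mul_le_mul (norm_fresnelPrimitive_le ht l) (hb' l hl) (norm_nonneg _) (by positivity)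
        have h2 : ‖fresnelError t l‖ * ‖h l‖ ≤ B ^ 2 * (2 / √t) :=
          calc ‖fresnelError t l‖ * ‖h l‖ ≤ ‖fresnelError t l‖ * (B ^ 2 * l) :=
                mul_le_mul_of_nonneg_left (hlin l hl) (norm_nonneg _)
            _ = B ^ 2 * (l * ‖fresnelError t l‖) := by ring
            _ ≤ B ^ 2 * (2 / √t) := by
                gcongr
                exact mul_norm_fresnelError_le ht hl.1
        calc _ ≤ 1 / √t * B ^ 2 + B ^ 2 * (2 / √t) := add_le_add h1 h2
          _ = 3 * B ^ 2 / √t := by ring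
    have hbdry : ‖fresnelPrimitive t L * h L‖ ≤ 1 / √t * B ^ 2 := by
      rw [norm_mul, Complex.norm_real]
      refine mul_le_mul (norm_fresnelPrimitive_le ht L) ?_ (norm_nonneg _) (by positivity)
      exact (hb L (right_mem_Icc.2 hL.le)).trans (by nlinarith)
    rw [hA, hsplit]
    refine (norm_sub_le _ _).trans ?_
    rw [sub_zero, abs_of_pos hL] at hrem
    have hq : 0 ≤ B ^ 2 / √t := by positivity
    have e1 : 1 / √t * B ^ 2 = B ^ 2 / √t := by ring
    have e2 : 3 * B ^ 2 / √t = 3 * (B ^ 2 / √t) := by ring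
    rw [e1] at hbdry
    rw [e2] at hrem ⊢
    nlinarith
  have hA0 : 0 ≤ A := norm_nonneg _
  have hB0 : 0 < B := by linarith
  have hsq : A ^ 2 ≤ 3 * B ^ 3 / √t := by
    calc A ^ 2 = A * A := sq A
      _ ≤ B * (3 * B ^ 2 / √t) := mul_le_mul trivial_bound decay_bound hA0 hB0.le
      _ = 3 * B ^ 3 / √t := by ring
  refine le_of_sq_le_sq (hsq.trans ?_) (by positivity)
  have e1 : (B ^ ((3 : ℝ) / 2)) ^ 2 = B ^ 3 := by
    rw [← Real.rpow_natCast, ← Real.rpow_mul hB0.le, ← Real.rpow_natCast]; norm_num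
  have e2 : (t ^ ((1 : ℝ) / 4)) ^ 2 = √t := by
    rw [← Real.rpow_natCast, ← Real.rpow_mul ht.le, Real.sqrt_eq_rpow]; norm_num
  rw [div_pow, mul_pow, e1, e2]
  gcongr
  norm_num

/-- Leading-order asymptotics of `∫ e^{itλ²} λ g(λ) dλ` for an amplitude `g` with `g(0) = 1`. -/
lemma norm_integral_exp_mul_id_mul_add_le {t L B : ℝ} (ht : 0 < t) (hL : 0 < L)
    (hL' : L ≤ 1 / 2) (hB : 1 ≤ B) {g g' g'' : ℝ → ℝ} (hd : ∀ l, HasDerivAt g (g' l) l)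
    (hd' : ∀ l, HasDerivAt g' (g'' l) l) (hc : Continuous g'') (hg0 : g 0 = 1) (hgL : g L = 0)
    (h0 : g' 0 = 0) (hb : ∀ l ∈ Icc 0 L, |g' l| ≤ B) (hb' : ∀ l ∈ Icc 0 L, |g'' l| ≤ B ^ 2) :
    ‖(∫ l in (0 : ℝ)..L, Complex.exp (Complex.I * t * l ^ 2) * l * (Complex.I / 2) * (g l : ℂ))
        + 1 / (4 * (t : ℂ))‖ ≤ B ^ ((3 : ℝ) / 2) / t ^ ((5 : ℝ) / 4) := by
  have hcont' : Continuous g' := continuous_iff_continuousAt.2 fun l => (hd' l).continuousAt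
  have htC : (t : ℂ) ≠ 0 := by exact_mod_cast ht.ne'
  have hparts := intervalIntegral.integral_mul_deriv_eq_deriv_mul (a := 0) (b := L)
    (u := fun l => (g l : ℂ)) (u' := fun l => (g' l : ℂ))
    (v := fun l : ℝ => Complex.exp (Complex.I * t * l ^ 2))
    (fun l _ => (hd l).ofReal_comp) (fun l _ => hasDerivAt_exp_I_mul_sq t l)
    (Continuous.intervalIntegrable (by fun_prop) _ _)
    (Continuous.intervalIntegrable (by fun_prop) _ _)
  have key : (∫ l in (0 : ℝ)..L,
        Complex.exp (Complex.I * t * l ^ 2) * l * (Complex.I / 2) * (g l : ℂ))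
      + 1 / (4 * (t : ℂ)) =
      -(1 / (4 * (t : ℂ))) *
        ∫ l in (0 : ℝ)..L, Complex.exp (Complex.I * t * l ^ 2) * (g' l : ℂ) := by
    have e1 : (∫ l in (0 : ℝ)..L,
        Complex.exp (Complex.I * t * l ^ 2) * l * (Complex.I / 2) * (g l : ℂ)) =
        1 / (4 * (t : ℂ)) * ∫ l in (0 : ℝ)..L,
          (g l : ℂ) * (Complex.exp (Complex.I * t * l ^ 2) * (2 * Complex.I * t * l)) := by
      rw [← intervalIntegral.integral_const_mul]
      congr 1
      ext l
      field_simp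
      ring
    have e2 : (∫ l in (0 : ℝ)..L, Complex.exp (Complex.I * t * l ^ 2) * (g' l : ℂ)) =
        ∫ l in (0 : ℝ)..L, (g' l : ℂ) * Complex.exp (Complex.I * t * l ^ 2) := by
      congr 1
      ext l
      ring
    rw [e1, e2, hparts]
    simp [hg0, hgL]
    ring
  rw [key, norm_mul]
  have hn : ‖-(1 / (4 * (t : ℂ)))‖ = 1 / (4 * t) := by
    simp [abs_of_pos ht]
  have hrp : t ^ ((5 : ℝ) / 4) = t * t ^ ((1 : ℝ) / 4) := by
    rw [← Real.rpow_one_add' ht.le (by norm_num)]; norm_num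
  rw [hn, hrp]
  calc _ ≤ 1 / (4 * t) * (2 * B ^ ((3 : ℝ) / 2) / t ^ ((1 : ℝ) / 4)) := by
        gcongr
        exact norm_integral_exp_mul_le ht hL hL' hB hd' hc h0 hb hb'
    _ = 1 / 2 * (B ^ ((3 : ℝ) / 2) / (t * t ^ ((1 : ℝ) / 4))) := by field_simp; ring
    _ ≤ _ := by
        have : 0 ≤ B ^ ((3 : ℝ) / 2) / (t * t ^ ((1 : ℝ) / 4)) := by
          have : 0 ≤ B := by linarith
          positivity
        linarith

/-- The oscillatory integral estimate with the Bessel function replaced by a single plane wave. -/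
lemma exists_plane_wave_bound {L : ℝ} (hL : 0 < L) (hL' : L ≤ 1 / 2) {χ : ℝ → ℝ}
    (hχ : ContDiff ℝ (⊤ : ℕ∞) χ) (h1 : ∀ s : ℝ, |s| ≤ L / 2 → χ s = 1) (hχL : χ L = 0) :
    ∃ M : ℝ, 1 ≤ M ∧ ∀ t a : ℝ, 0 < t →
      ‖(∫ l in (0 : ℝ)..L, Complex.exp (Complex.I * t * l ^ 2) * l * (Complex.I / 2) *
          ((χ l * Real.cos (l * a) : ℝ) : ℂ)) + 1 / (4 * (t : ℂ))‖ ≤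
        (M * (1 + |a|)) ^ ((3 : ℝ) / 2) / t ^ ((5 : ℝ) / 4) := by
  have hχ2 : ContDiff ℝ 2 χ := by exact_mod_cast contDiff_infty.1 hχ 2
  have hχ1' : ContDiff ℝ 1 (deriv χ) := ((contDiff_succ_iff_deriv (n := 1)).1 hχ2).2.2
  have hd : ∀ l, HasDerivAt χ (deriv χ l) l := fun l =>
    ((hχ2.differentiable (by norm_num)) l).hasDerivAt
  have hd' : ∀ l, HasDerivAt (deriv χ) (deriv (deriv χ) l) l := fun l =>
    ((hχ1'.differentiable (by norm_num)) l).hasDerivAt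
  have hc0 : Continuous χ := hχ2.continuous
  have hc1 : Continuous (deriv χ) := hχ1'.continuous
  have hc2 : Continuous (deriv (deriv χ)) := hχ1'.continuous_deriv le_rfl
  obtain ⟨M0, hM0⟩ := isCompact_Icc.exists_bound_of_continuousOn (s := Icc 0 L) hc0.continuousOn
  obtain ⟨M1, hM1⟩ := isCompact_Icc.exists_bound_of_continuousOn (s := Icc 0 L) hc1.continuousOn
  obtain ⟨M2, hM2⟩ := isCompact_Icc.exists_bound_of_continuousOn (s := Icc 0 L) hc2.continuousOn
  have hχ0 : deriv χ 0 = 0 := by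
    have : χ =ᶠ[nhds 0] fun _ => (1 : ℝ) := by
      filter_upwards [Metric.ball_mem_nhds (0 : ℝ) (half_pos hL)] with s hs
      exact h1 s (by simpa using (mem_ball_zero_iff.1 hs).le)
    rw [this.deriv_eq]
    simp
  set M := max 1 (max M0 (max M1 M2)) with hM
  have hM_one : 1 ≤ M := le_max_left _ _
  have hm0 : ∀ l ∈ Icc 0 L, |χ l| ≤ M := fun l hl => (hM0 l hl).trans (by simp [hM])
  have hm1 : ∀ l ∈ Icc 0 L, |deriv χ l| ≤ M := fun l hl => (hM1 l hl).trans (by simp [hM])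
  have hm2 : ∀ l ∈ Icc 0 L, |deriv (deriv χ) l| ≤ M := fun l hl =>
    (hM2 l hl).trans (by simp [hM])
  refine ⟨M, hM_one, fun t a ht => ?_⟩
  have ha := abs_nonneg a
  have hcos : ∀ l, HasDerivAt (fun l => Real.cos (l * a)) (-Real.sin (l * a) * a) l := fun l => by
    simpa using ((hasDerivAt_id l).mul_const a).cos
  have hsin : ∀ l, HasDerivAt (fun l => Real.sin (l * a)) (Real.cos (l * a) * a) l := fun l => by
    simpa using ((hasDerivAt_id l).mul_const a).sin
  refine norm_integral_exp_mul_id_mul_add_le (B := M * (1 + |a|)) ht hL hL' (by nlinarith)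
    (g' := fun l => deriv χ l * Real.cos (l * a) + χ l * (-Real.sin (l * a) * a))
    (g'' := fun l => (deriv (deriv χ) l * Real.cos (l * a) +
      deriv χ l * (-Real.sin (l * a) * a)) + (deriv χ l * (-Real.sin (l * a) * a) +
        χ l * (-(Real.cos (l * a) * a) * a)))
    (fun l => (hd l).mul (hcos l))
    (fun l => ((hd' l).mul (hcos l)).add ((hd l).mul ((hsin l).neg.mul_const a)))
    (by fun_prop) (by simp [h1 0 (by simpa using (half_pos hL).le)])
    (by simp [hχL]) (by simp [hχ0]) ?_ ?_
  · intro l hl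
    have c1 := Real.abs_cos_le_one (l * a)
    have s1 := Real.abs_sin_le_one (l * a)
    calc _ ≤ |deriv χ l * Real.cos (l * a)| + |χ l * (-Real.sin (l * a) * a)| := abs_add_le _ _
      _ = |deriv χ l| * |Real.cos (l * a)| + |χ l| * (|Real.sin (l * a)| * |a|) := by
          simp only [abs_mul, abs_neg]
      _ ≤ M * 1 + M * (1 * |a|) := by
          gcongr
          exacts [hm1 l hl, hm0 l hl]
      _ = M * (1 + |a|) := by ring
  · intro l hl
    have c1 := Real.abs_cos_le_one (l * a)
    have s1 := Real.abs_sin_le_one (l * a)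
    calc _ ≤ (|deriv (deriv χ) l * Real.cos (l * a)| + |deriv χ l * (-Real.sin (l * a) * a)|) +
            (|deriv χ l * (-Real.sin (l * a) * a)| + |χ l * (-(Real.cos (l * a) * a) * a)|) :=
          (abs_add_le _ _).trans (add_le_add (abs_add_le _ _) (abs_add_le _ _))
      _ = (|deriv (deriv χ) l| * |Real.cos (l * a)| +
            |deriv χ l| * (|Real.sin (l * a)| * |a|)) +
            (|deriv χ l| * (|Real.sin (l * a)| * |a|) +
              |χ l| * (|Real.cos (l * a)| * |a| * |a|)) := by
          simp only [abs_mul, abs_neg]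
      _ ≤ (M * 1 + M * (1 * |a|)) + (M * (1 * |a|) + M * (1 * |a| * |a|)) := by
          gcongr
          exacts [hm2 l hl, hm1 l hl, hm1 l hl, hm0 l hl]
      _ = M * (1 + |a|) ^ 2 := by ring
      _ ≤ (M * (1 + |a|)) ^ 2 := by
          rw [mul_pow]
          gcongr
          nlinarith

lemma one_add_norm_sub_le_jap (x y : Plane) : 1 + ‖x - y‖ ≤ 2 * (jap x * jap y) := by
  have hx := norm_nonneg x
  have hy := norm_nonneg y
  unfold jap
  rw [← Real.mul_rpow (by positivity) (by positivity), ← Real.sqrt_eq_rpow]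
  have h := Real.abs_le_sqrt (x := (1 + ‖x‖) * (1 + ‖y‖) / 2)
    (y := (1 + ‖x‖ ^ 2) * (1 + ‖y‖ ^ 2)) (by
      have h1 : (1 + ‖x‖) ^ 2 ≤ 2 * (1 + ‖x‖ ^ 2) := by nlinarith [sq_nonneg (‖x‖ - 1)]
      have h2 : (1 + ‖y‖) ^ 2 ≤ 2 * (1 + ‖y‖ ^ 2) := by nlinarith [sq_nonneg (‖y‖ - 1)]
      have := mul_le_mul h1 h2 (by positivity) (by positivity)
      nlinarith)
  have h' := (le_abs_self _).trans h
  nlinarith [norm_sub_le x y, mul_nonneg hx hy]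

/-- The Bessel kernel integral is the average over `θ ∈ [0, π]` of its plane wave analogues. -/
lemma integral_bessel_add_eq {L : ℝ} (hL : 0 < L) {χ : ℝ → ℝ} (hχ : Continuous χ)
    (h0 : ∀ s : ℝ, L ≤ |s| → χ s = 0) (t r : ℝ) :
    (∫ l in Set.Ioi (0 : ℝ), Complex.exp (Complex.I * t * l ^ 2) * l * (χ l : ℂ) *
        (Complex.I / 2) * (J0 (l * r) : ℂ)) + 1 / (4 * (t : ℂ)) =
      (1 / Real.pi : ℝ) * ∫ θ in (0 : ℝ)..Real.pi,
        ((∫ l in (0 : ℝ)..L, Complex.exp (Complex.I * t * l ^ 2) * l * (Complex.I / 2) *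
          ((χ l * Real.cos (l * (r * Real.sin θ)) : ℝ) : ℂ)) + 1 / (4 * (t : ℂ))) := by
  have hcont : Continuous (Function.uncurry fun (l θ : ℝ) =>
      Complex.exp (Complex.I * t * l ^ 2) * l * (Complex.I / 2) *
          ((χ l * Real.cos (l * (r * Real.sin θ)) : ℝ) : ℂ)) := by
    unfold Function.uncurry
    fun_prop
  have hrestrict : (∫ l in Set.Ioi (0 : ℝ), Complex.exp (Complex.I * t * l ^ 2) * l * (χ l : ℂ) *
        (Complex.I / 2) * (J0 (l * r) : ℂ)) =
      ∫ l in (0 : ℝ)..L, Complex.exp (Complex.I * t * l ^ 2) * l * (χ l : ℂ) *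
        (Complex.I / 2) * (J0 (l * r) : ℂ) := by
    rw [intervalIntegral.integral_of_le hL.le]
    refine (setIntegral_eq_of_subset_of_forall_sdiff_eq_zero measurableSet_Ioi
      (fun l hl => hl.1) fun l hl => ?_)
    have : L ≤ |l| := by
      have h1 : 0 < l := hl.1
      by_contra! h
      exact hl.2 ⟨h1, ((le_abs_self l).trans h.le)⟩
    simp [h0 l this]
  have hbessel : ∀ l : ℝ, Complex.exp (Complex.I * t * l ^ 2) * l * (χ l : ℂ) *
        (Complex.I / 2) * (J0 (l * r) : ℂ) = (1 / Real.pi : ℝ) * ∫ θ in (0 : ℝ)..Real.pi,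
        Complex.exp (Complex.I * t * l ^ 2) * l * (Complex.I / 2) *
          ((χ l * Real.cos (l * (r * Real.sin θ)) : ℝ) : ℂ) := by
    intro l
    rw [intervalIntegral.integral_const_mul, intervalIntegral.integral_ofReal,
      intervalIntegral.integral_const_mul]
    simp only [J0, mul_assoc l r]
    push_cast
    ring
  have hswap : (∫ l in (0 : ℝ)..L, ∫ θ in (0 : ℝ)..Real.pi,
        Complex.exp (Complex.I * t * l ^ 2) * l * (Complex.I / 2) *
          ((χ l * Real.cos (l * (r * Real.sin θ)) : ℝ) : ℂ)) =
      ∫ θ in (0 : ℝ)..Real.pi, ∫ l in (0 : ℝ)..L,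
        Complex.exp (Complex.I * t * l ^ 2) * l * (Complex.I / 2) *
          ((χ l * Real.cos (l * (r * Real.sin θ)) : ℝ) : ℂ) := by
    refine intervalIntegral_intervalIntegral_swap ?_
    exact (hcont.continuousOn.integrableOn_compact
      (isCompact_uIcc.prod isCompact_uIcc)).mono_set
        (prod_mono uIoc_subset_uIcc uIoc_subset_uIcc)
  have hcθ : Continuous fun θ : ℝ => ∫ l in (0 : ℝ)..L,
      Complex.exp (Complex.I * t * l ^ 2) * l * (Complex.I / 2) *
        ((χ l * Real.cos (l * (r * Real.sin θ)) : ℝ) : ℂ) := by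
    apply intervalIntegral.continuous_parametric_intervalIntegral_of_continuous'
    unfold Function.uncurry
    fun_prop
  rw [hrestrict, intervalIntegral.integral_add (hcθ.intervalIntegrable _ _)
    (intervalIntegrable_const), ← hswap, intervalIntegral.integral_const]
  simp_rw [hbessel]
  rw [intervalIntegral.integral_const_mul, mul_add]
  congr 1
  have := Real.pi_ne_zero
  have hpi : (Real.pi : ℂ) ≠ 0 := by exact_mod_cast this
  rw [sub_zero, Complex.real_smul]
  push_cast
  field_simp

/-- Contribution of the free resolvent: for a smooth even cutoff `χ`
supported near zero (with sufficiently small support `λ₁`),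
`|∫₀^∞ e^{itλ²} λ χ(λ)(i/2)J₀(λ|x−y|) dλ + 1/(4t)| ≤ C⟨x⟩^{3/2}⟨y⟩^{3/2}/t^{5/4}` for `t > 2`. -/
theorem free_resolvent_evolution_bound :
    ∃ lam0 : ℝ, lam0 ∈ Set.Ioc (0:ℝ) (1/2) ∧
      ∀ lam1 : ℝ, 0 < lam1 → lam1 ≤ lam0 →
        ∀ χ : ℝ → ℝ, ContDiff ℝ (⊤ : ℕ∞) χ → (∀ s : ℝ, χ (-s) = χ s) →
          (∀ s : ℝ, |s| ≤ lam1 / 2 → χ s = 1) → (∀ s : ℝ, lam1 ≤ |s| → χ s = 0) →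
          ∃ C : ℝ, 0 < C ∧ ∀ t : ℝ, 2 < t → ∀ x y : Plane,
            ‖(∫ l in Set.Ioi (0:ℝ),
                Complex.exp (Complex.I * t * l ^ 2) * l * (χ l : ℂ) *
                  (Complex.I / 2) * (J0 (l * ‖x - y‖) : ℂ)) + 1 / (4 * (t : ℂ))‖ ≤
              C * jap x ^ ((3:ℝ)/2) * jap y ^ ((3:ℝ)/2) / t ^ ((5:ℝ)/4) := by
  refine ⟨1 / 2, by norm_num, fun L hL hL' χ hχ _ h1 h0 => ?_⟩
  obtain ⟨M, hM, hbound⟩ := exists_plane_wave_bound hL hL' hχ h1 (h0 L (le_abs_self L))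
  refine ⟨(2 * M) ^ ((3 : ℝ) / 2), by positivity, fun t ht x y => ?_⟩
  have ht0 : 0 < t := by linarith
  have hjx : 0 ≤ jap x := by unfold jap; positivity
  have hjy : 0 ≤ jap y := by unfold jap; positivity
  rw [integral_bessel_add_eq hL hχ.continuous h0 t ‖x - y‖, norm_mul, Complex.norm_real,
    Real.norm_of_nonneg (by positivity)]
  have hθ := intervalIntegral.norm_integral_le_of_norm_le_const (a := 0) (b := Real.pi)
    (C := (2 * M) ^ ((3 : ℝ) / 2) * jap x ^ ((3 : ℝ) / 2) * jap y ^ ((3 : ℝ) / 2) /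
      t ^ ((5 : ℝ) / 4))
    (f := fun θ : ℝ => (∫ l in (0 : ℝ)..L, Complex.exp (Complex.I * t * l ^ 2) * l *
      (Complex.I / 2) * ((χ l * Real.cos (l * (‖x - y‖ * Real.sin θ)) : ℝ) : ℂ)) +
        1 / (4 * (t : ℂ))) fun θ _ => by
      refine (hbound t (‖x - y‖ * Real.sin θ) ht0).trans ?_
      rw [← Real.mul_rpow (by positivity) hjx, ← Real.mul_rpow (by positivity) hjy]
      have hle : |‖x - y‖ * Real.sin θ| ≤ ‖x - y‖ := by
        rw [abs_mul, abs_norm]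
        exact mul_le_of_le_one_right (norm_nonneg _) (Real.abs_sin_le_one θ)
      refine div_le_div_of_nonneg_right (Real.rpow_le_rpow (by positivity) ?_ (by norm_num))
        (by positivity)
      calc M * (1 + |‖x - y‖ * Real.sin θ|) ≤ M * (2 * (jap x * jap y)) := by
            gcongr
            linarith [one_add_norm_sub_le_jap x y]
        _ = 2 * M * jap x * jap y := by ring
  rw [sub_zero, abs_of_pos Real.pi_pos] at hθ
  rw [one_div, inv_mul_le_iff₀ Real.pi_pos, mul_comm Real.pi]
  exact hθ
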